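/- arXiv:2306.07390 — 2 statements merged into one kernel-verified Lean document; each statement's English description precedes it below -/
import Mathlib

section
/- Let V be a finite-dimensional real vector space and p ≥ 1. Then the space Y_p(V) of symmetric bilinear forms on ⋀^p V decomposes as a direct sum Y_p(V) = Z_p(V) ⊕ A_p(V). -/
open ExteriorAlgebra Module

variable (p : ℕ) (V : Type*) [AddCommGroup V] [Module ℝ V] [FiniteDimensional ℝ V]

instance extPower_finite : Module.Finite ℝ ↥(⋀[ℝ]^p V) := by
  refine Module.Finite.iff_fg.mpr (Submodule.FG.pow ?_ p)
  rw [← Submodule.map_top]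
  exact (Module.finite_def.mp inferInstance).map _

/-- The decomposable (wedge) vector `v 1 ∧ ⋯ ∧ v p` in the `p`-th exterior power of `V`. -/
noncomputable def wedge (v : Fin p → V) : ↥(⋀[ℝ]^p V) :=
  ⟨ExteriorAlgebra.ιMulti ℝ p v, ExteriorAlgebra.ιMulti_range ℝ p (Set.mem_range_self v)⟩

/-- The canonical lift of an alternating `p`-form on `V` (with values in `N`) to a linear map
on the `p`-th exterior power of `V`, bundled as a linear map. -/
noncomputable def liftAltPower {N : Type*} [AddCommGroup N] [Module ℝ N] :
    (AlternatingMap ℝ V N (Fin p)) →ₗ[ℝ] (↥(⋀[ℝ]^p V) →ₗ[ℝ] N) where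
  toFun g := (ExteriorAlgebra.liftAlternating (Pi.single p g)) ∘ₗ (⋀[ℝ]^p V).subtype
  map_add' g h := by
    show ExteriorAlgebra.liftAlternating (Pi.single p (g + h)) ∘ₗ (⋀[ℝ]^p V).subtype = _
    rw [Pi.single_add, map_add, LinearMap.add_comp]
  map_smul' c g := by
    show ExteriorAlgebra.liftAlternating (Pi.single p (c • g)) ∘ₗ (⋀[ℝ]^p V).subtype = _
    rw [Pi.single_smul, map_smul, LinearMap.smul_comp]
    rfl

/-- The image of the decomposable element `f 1 ∧ ⋯ ∧ f p` of `⋀^p (V^*)` under the canonical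
identification of `⋀^p (V^*)` with the dual space of `⋀^p V` (it is the linear functional
determined by `v₁ ∧ ⋯ ∧ v_p ↦ det (f i (v j))`). -/
noncomputable def dualWedge (f : Fin p → Module.Dual ℝ V) : Module.Dual ℝ ↥(⋀[ℝ]^p V) :=
  liftAltPower p V (Matrix.detRowAlternating.compLinearMap (LinearMap.pi f))

/-- `Y_p(V)`: the space of symmetric bilinear forms on `⋀^p V`, as a submodule of the space of
all bilinear forms on `⋀^p V`. -/
noncomputable def Yp : Submodule ℝ (↥(⋀[ℝ]^p V) →ₗ[ℝ] ↥(⋀[ℝ]^p V) →ₗ[ℝ] ℝ) where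
  carrier := {B | ∀ x y, B x y = B y x}
  add_mem' := by intro B C hB hC x y; simp [hB x y, hC x y]
  zero_mem' := by intro x y; simp
  smul_mem' := by intro c B hB x y; simp [hB x y]

/-- `Z_p(V)`: the space of symmetric bilinear forms on `⋀^p V` whose associated quadratic form
vanishes on all decomposable vectors. -/
noncomputable def Zp : Submodule ℝ (↥(⋀[ℝ]^p V) →ₗ[ℝ] ↥(⋀[ℝ]^p V) →ₗ[ℝ] ℝ) where
  carrier := {B | (∀ x y, B x y = B y x) ∧ ∀ v : Fin p → V, B (wedge p V v) (wedge p V v) = 0}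
  add_mem' := by
    intro B C hB hC
    exact ⟨fun x y => by simp [hB.1 x y, hC.1 x y], fun v => by simp [hB.2 v, hC.2 v]⟩
  zero_mem' := ⟨fun x y => by simp, fun v => by simp⟩
  smul_mem' := by
    intro c B hB
    exact ⟨fun x y => by simp [hB.1 x y], fun v => by simp [hB.2 v]⟩

/-- `Z_p(V^*)`: the space of symmetric bilinear forms on `⋀^p (V^*)` (realized, via the
canonical finite-dimensional identification, on the dual space of `⋀^p V`) whose associated
quadratic form vanishes on all decomposable vectors of `⋀^p (V^*)`. -/
noncomputable def ZpDual : Submodule ℝ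
    (Module.Dual ℝ ↥(⋀[ℝ]^p V) →ₗ[ℝ] Module.Dual ℝ ↥(⋀[ℝ]^p V) →ₗ[ℝ] ℝ) where
  carrier := {C | (∀ x y, C x y = C y x) ∧
    ∀ f : Fin p → Module.Dual ℝ V, C (dualWedge p V f) (dualWedge p V f) = 0}
  add_mem' := by
    intro B C hB hC
    exact ⟨fun x y => by simp [hB.1 x y, hC.1 x y], fun v => by simp [hB.2 v, hC.2 v]⟩
  zero_mem' := ⟨fun x y => by simp, fun v => by simp⟩
  smul_mem' := by
    intro c B hB
    exact ⟨fun x y => by simp [hB.1 x y], fun v => by simp [hB.2 v]⟩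

/-- The perfect-duality pairing `⟨B, C⟩ = tr (B̂ ∘ Ĉ)` between bilinear forms on `⋀^p V` and
bilinear forms on `⋀^p (V^*)` (the latter realized on the dual of `⋀^p V` via the canonical
finite-dimensional identification, and `Ĉ : (⋀^p V)^* → ⋀^p V` being obtained from `C` using
the canonical identification of a finite-dimensional space with its double dual). -/
noncomputable def pairingY
    (B : ↥(⋀[ℝ]^p V) →ₗ[ℝ] ↥(⋀[ℝ]^p V) →ₗ[ℝ] ℝ)
    (C : Module.Dual ℝ ↥(⋀[ℝ]^p V) →ₗ[ℝ] Module.Dual ℝ ↥(⋀[ℝ]^p V) →ₗ[ℝ] ℝ) : ℝ :=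
  LinearMap.trace ℝ ↥(⋀[ℝ]^p V)
    ((Module.evalEquiv ℝ ↥(⋀[ℝ]^p V)).symm.toLinearMap ∘ₗ C ∘ₗ B)

/-- `A_p(V)`: the subspace of symmetric bilinear forms on `⋀^p V` annihilating `Z_p(V^*)`
under the canonical perfect-duality pairing. -/
noncomputable def Ap : Submodule ℝ (↥(⋀[ℝ]^p V) →ₗ[ℝ] ↥(⋀[ℝ]^p V) →ₗ[ℝ] ℝ) where
  carrier := {B | (∀ x y, B x y = B y x) ∧ ∀ C ∈ ZpDual p V, pairingY p V B C = 0}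
  add_mem' := by
    intro B B' hB hB'
    refine ⟨fun x y => by simp [hB.1 x y, hB'.1 x y], fun C hC => ?_⟩
    have h : pairingY p V (B + B') C = pairingY p V B C + pairingY p V B' C := by
      simp [pairingY, LinearMap.comp_add, LinearMap.add_comp, map_add]
    rw [h, hB.2 C hC, hB'.2 C hC, add_zero]
  zero_mem' := by
    refine ⟨fun x y => by simp, fun C hC => ?_⟩
    simp [pairingY]
  smul_mem' := by
    intro c B hB
    refine ⟨fun x y => by simp [hB.1 x y], fun C hC => ?_⟩
    have h : pairingY p V (c • B) C = c * pairingY p V B C := by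
      simp [pairingY, LinearMap.comp_smul, LinearMap.smul_comp, map_smul]
    rw [h, hB.2 C hC, mul_zero]

lemma dualWedge_wedge (f : Fin p → Module.Dual ℝ V) (v : Fin p → V) :
    dualWedge p V f (wedge p V v) = Matrix.det (Matrix.of fun i j => f j (v i)) := by
  simp only [dualWedge, liftAltPower, wedge, LinearMap.coe_mk, AddHom.coe_mk,
    LinearMap.comp_apply, Submodule.subtype_apply]
  rw [ExteriorAlgebra.liftAlternating_apply_ιMulti, Pi.single_eq_same]
  rfl

lemma dualWedge_eq (f : Fin p → Module.Dual ℝ V) :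
    dualWedge p V f = exteriorPower.pairingDual ℝ V p (exteriorPower.ιMulti ℝ p f) := by
  apply exteriorPower.linearMap_ext
  ext v
  simp only [LinearMap.compAlternatingMap_apply]
  rw [exteriorPower.pairingDual_ιMulti_ιMulti]
  exact dualWedge_wedge p V f v

lemma exists_good_basis : ∃ (ι : Type) (_ : Fintype ι) (_ : DecidableEq ι)
    (b : Basis ι ℝ ↥(⋀[ℝ]^p V)) (φ : V ≃ₗ[ℝ] Module.Dual ℝ V),
    ∀ v : Fin p → V, b.toDualEquiv (wedge p V v) = dualWedge p V (fun i => φ (v i)) := by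
  classical
  let e := Module.finBasis ℝ V
  let b := e.exteriorPower p
  refine ⟨Set.powersetCard (Fin (finrank ℝ V)) p, inferInstance, inferInstance, b,
    e.toDualEquiv, fun v => ?_⟩
  have key : b.toDual = exteriorPower.pairingDual ℝ V p ∘ₗ exteriorPower.map p e.toDual := by
    apply b.ext
    intro s
    rw [Basis.coe_toDual_self, LinearMap.comp_apply]
    simp only [b]
    rw [exteriorPower.basis_apply, exteriorPower.map_apply_ιMulti_family,
      exteriorPower.basis_coord, exteriorPower.ιMultiDual]
    congr 2
    ext i : 1
    exact (e.coe_toDual_self i).symm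
  rw [Basis.toDualEquiv_apply, key, dualWedge_eq, LinearMap.comp_apply]
  exact congrArg _ (exteriorPower.map_apply_ιMulti _ _)

/-- Transport of a bilinear form to the dual space. -/
noncomputable def transportForm {E F : Type*} [AddCommGroup E] [Module ℝ E] [AddCommGroup F]
    [Module ℝ F] (Φ : E →ₗ[ℝ] F) (C : F →ₗ[ℝ] F →ₗ[ℝ] ℝ) : E →ₗ[ℝ] E →ₗ[ℝ] ℝ :=
  C.compl₁₂ Φ Φ

lemma transportForm_apply {E F : Type*} [AddCommGroup E] [Module ℝ E] [AddCommGroup F]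
    [Module ℝ F] (Φ : E →ₗ[ℝ] F) (C : F →ₗ[ℝ] F →ₗ[ℝ] ℝ) (x y : E) :
    transportForm Φ C x y = C (Φ x) (Φ y) := rfl

lemma pairing_eq {ι : Type} [Fintype ι] [DecidableEq ι] (b : Basis ι ℝ ↥(⋀[ℝ]^p V))
    (B : ↥(⋀[ℝ]^p V) →ₗ[ℝ] ↥(⋀[ℝ]^p V) →ₗ[ℝ] ℝ)
    (C : Module.Dual ℝ ↥(⋀[ℝ]^p V) →ₗ[ℝ] Module.Dual ℝ ↥(⋀[ℝ]^p V) →ₗ[ℝ] ℝ) :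
    pairingY p V B C = ∑ i, ∑ j, B (b i) (b j) *
      C (b.toDualEquiv (b j)) (b.toDualEquiv (b i)) := by
  rw [pairingY, LinearMap.trace_eq_matrix_trace ℝ b, Matrix.trace]
  refine Finset.sum_congr rfl fun i _ => ?_
  rw [Matrix.diag_apply, LinearMap.toMatrix_apply, ← Basis.coord_apply]
  simp only [LinearMap.comp_apply, LinearEquiv.coe_coe]
  rw [Module.apply_evalEquiv_symm_apply]
  have h : B (b i) = ∑ j, B (b i) (b j) • b.coord j := by
    apply b.ext
    intro k
    simp [Finsupp.single_apply]
  conv_lhs => rw [h]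
  simp [Basis.toDualEquiv_apply, ← Basis.coe_toDual_self]

lemma exists_orthogonal_decomp {W : Type*} [AddCommGroup W] [Module ℝ W] [FiniteDimensional ℝ W]
    (S : LinearMap.BilinForm ℝ W) (hsymm : ∀ x y, S x y = S y x) (hdef : ∀ x, S x x = 0 → x = 0)
    (Z : Submodule ℝ W) (B : W) : ∃ z ∈ Z, ∃ w : W, (∀ D ∈ Z, S D w = 0) ∧ z + w = B := by
  have hrefl : S.IsRefl := by
    intro x y h
    rw [hsymm, h]
  have hc : IsCompl Z (S.orthogonal Z) := by
    rw [LinearMap.BilinForm.isCompl_orthogonal_iff_disjoint hrefl, Submodule.disjoint_def]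
    intro x hx hx2
    exact hdef x (hx2 x hx)
  have hB : B ∈ Z ⊔ S.orthogonal Z := by
    rw [hc.sup_eq_top]; trivial
  obtain ⟨z, hz, w, hw, h⟩ := Submodule.mem_sup.1 hB
  exact ⟨z, hz, w, fun D hD => hw D hD, h⟩

set_option maxHeartbeats 2000000 in
/-- for a finite-dimensional real vector space `V` and `p ≥ 1`, the space
`Y_p(V)` of symmetric bilinear forms on `⋀^p V` decomposes as the direct sum
`Y_p(V) = Z_p(V) ⊕ A_p(V)`. -/
theorem Yp_eq_Zp_directSum_Ap (hp : 1 ≤ p) :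
    Zp p V ⊓ Ap p V = ⊥ ∧ Zp p V ⊔ Ap p V = Yp p V := by
  obtain ⟨ι, _, _, b, φ, hφ⟩ := exists_good_basis p V
  let S : LinearMap.BilinForm ℝ (↥(⋀[ℝ]^p V) →ₗ[ℝ] ↥(⋀[ℝ]^p V) →ₗ[ℝ] ℝ) :=
    LinearMap.mk₂ ℝ (fun B D => ∑ i, ∑ j, B (b i) (b j) * D (b i) (b j))
      (by intros; simp [add_mul, Finset.sum_add_distrib])
      (by intros; simp [Finset.mul_sum, mul_assoc])
      (by intros; simp [mul_add, Finset.sum_add_distrib])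
      (by intros; simp [Finset.mul_sum, mul_left_comm])
  have hS : ∀ B D, S B D = ∑ i, ∑ j, B (b i) (b j) * D (b i) (b j) := fun _ _ => rfl
  have hSsymm : ∀ B D, S B D = S D B := by
    intro B D; simp only [hS, mul_comm]
  have hSdef : ∀ B, S B B = 0 → B = 0 := by
    intro B h
    rw [hS, Finset.sum_eq_zero_iff_of_nonneg
      (fun i _ => Finset.sum_nonneg fun j _ => mul_self_nonneg _)] at h
    apply b.ext
    intro i
    apply b.ext
    intro j
    have := h i (Finset.mem_univ _)
    rw [Finset.sum_eq_zero_iff_of_nonneg (fun j _ => mul_self_nonneg _)] at this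
    simpa using this j (Finset.mem_univ _)
  have hA : ∀ B, B ∈ Ap p V ↔ (B ∈ Yp p V ∧ ∀ D ∈ Zp p V, S D B = 0) := by
    have hpair := pairing_eq p V b
    clear_value S
    clear hSdef
    generalize b.toDualEquiv = Φ at hφ hpair
    intro B
    refine and_congr_right fun hB => ⟨fun h D hD => ?_, fun h C hC => ?_⟩
    · have hmem : transportForm Φ.symm.toLinearMap D ∈ ZpDual p V := by
        refine ⟨fun x y => ?_, fun f => ?_⟩
        · rw [transportForm_apply, transportForm_apply, hD.1]
        · have h2 := hφ (fun i => φ.symm (f i))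
          simp only [LinearEquiv.apply_symm_apply] at h2
          rw [← h2, transportForm_apply, LinearEquiv.coe_coe, LinearEquiv.symm_apply_apply]
          exact hD.2 (fun i => φ.symm (f i))
      have := h _ hmem
      rw [hpair] at this
      rw [hSsymm, hS, ← this]
      refine Finset.sum_congr rfl fun i _ => Finset.sum_congr rfl fun j _ => ?_
      rw [transportForm_apply, LinearEquiv.coe_coe, LinearEquiv.symm_apply_apply,
        LinearEquiv.symm_apply_apply, hD.1 (b i) (b j)]
    · have hmem : transportForm Φ.toLinearMap C ∈ Zp p V := by
        refine ⟨fun x y => ?_, fun v => ?_⟩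
        · rw [transportForm_apply, transportForm_apply, hC.1]
        · rw [transportForm_apply, LinearEquiv.coe_coe, hφ]
          exact hC.2 (fun i => φ (v i))
      have := h _ hmem
      rw [hpair, ← this, hSsymm, hS]
      refine Finset.sum_congr rfl fun i _ => Finset.sum_congr rfl fun j _ => ?_
      rw [hC.1, transportForm_apply, LinearEquiv.coe_coe]
  have hZY : Zp p V ≤ Yp p V := fun B hB => hB.1
  constructor
  · rw [eq_bot_iff]
    intro B hB
    exact hSdef B (((hA B).1 hB.2).2 B hB.1)
  · apply le_antisymm
    · exact sup_le hZY fun B hB => hB.1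
    · intro B hB
      obtain ⟨z, hz, w, hw, rfl⟩ := exists_orthogonal_decomp S hSsymm hSdef (Zp p V) B
      refine Submodule.add_mem_sup hz ((hA w).2 ⟨?_, hw⟩)
      intro x y
      have h1 := hB x y
      have h2 := hz.1 x y
      simp only [LinearMap.add_apply] at h1
      linarith
end

section
/- Let V be a finite-dimensional real vector space and p ≥ 1. The group GL(V) acts on Y_p(V) by (g · Q)(x, y) = Q((⋀^p g)^{-1} x, (⋀^p g)^{-1} y). If U ⊆ Y_p(V) is a GL(V)-invariant linear subspace with Y_p(V) = Z_p(V) ⊕ U, then U = A_p(V); that is, A_p(V) is the unique GL(V)-invariant complement of Z_p(V) in Y_p(V). -/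
open ExteriorAlgebra Module

variable (p : ℕ) (V : Type*) [AddCommGroup V] [Module ℝ V] [FiniteDimensional ℝ V]

variable {V}

lemma map_mem_extPower {M N : Type*} [AddCommGroup M] [Module ℝ M] [AddCommGroup N]
    [Module ℝ N] (f : M →ₗ[ℝ] N) {x : ExteriorAlgebra ℝ M} (hx : x ∈ ⋀[ℝ]^p M) :
    ExteriorAlgebra.map f x ∈ ⋀[ℝ]^p N := by
  have h : Submodule.map (ExteriorAlgebra.map f).toLinearMap (⋀[ℝ]^p M) ≤ ⋀[ℝ]^p N := by
    rw [Submodule.map_pow]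
    refine pow_le_pow_left' ?_ p
    rw [ExteriorAlgebra.ι_range_map_map]
    rintro y ⟨z, -, rfl⟩
    exact LinearMap.mem_range_self _ _
  exact h ⟨x, hx, rfl⟩

/-- The map induced on `p`-th exterior powers by a linear map. -/
noncomputable def extPowMap {M N : Type*} [AddCommGroup M] [Module ℝ M] [AddCommGroup N]
    [Module ℝ N] (f : M →ₗ[ℝ] N) : ↥(⋀[ℝ]^p M) →ₗ[ℝ] ↥(⋀[ℝ]^p N) :=
  ((ExteriorAlgebra.map f).toLinearMap.comp (⋀[ℝ]^p M).subtype).codRestrict _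
    (fun x => map_mem_extPower p f x.2)

variable (V)

namespace InvCompl

lemma sub_mem' {p : ℕ} {V : Type*} [AddCommGroup V] [Module ℝ V]
    {S : Submodule ℝ (↥(⋀[ℝ]^p V) →ₗ[ℝ] ↥(⋀[ℝ]^p V) →ₗ[ℝ] ℝ)} {x y} (hx : x ∈ S) (hy : y ∈ S) :
    x - y ∈ S := by
  have h : x - y = x + (-1 : ℝ) • y := by
    refine LinearMap.ext fun a => LinearMap.ext fun b => ?_
    simp [sub_eq_add_neg]
  rw [h]
  exact S.add_mem hx (S.smul_mem _ hy)

lemma mem_right {p : ℕ} {V : Type*} [AddCommGroup V] [Module ℝ V]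
    {S : Submodule ℝ (↥(⋀[ℝ]^p V) →ₗ[ℝ] ↥(⋀[ℝ]^p V) →ₗ[ℝ] ℝ)} {k z}
    (hx : k + z ∈ S) (hy : k ∈ S) : z ∈ S := by
  have h : z = k + z + (-1 : ℝ) • k := by
    refine LinearMap.ext fun a => LinearMap.ext fun b => ?_
    simp
  rw [h]
  exact S.add_mem hx (S.smul_mem _ hy)

lemma scal {c d t : ℝ} (h1 : c * (d * t) = t) (h2 : 2 ≤ c * d) : t = 0 := by
  have h3 : (c * d - 1) * t = 0 := by linear_combination h1
  rcases mul_eq_zero.mp h3 with h4 | h4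
  · linarith
  · exact h4

lemma wedge_eq (v : Fin p → V) : wedge p V v = exteriorPower.ιMulti ℝ p v := rfl

lemma dualWedge_wedge (f : Fin p → Module.Dual ℝ V) (v : Fin p → V) :
    dualWedge p V f (wedge p V v) = (Matrix.of fun i j => f j (v i)).det := by
  have h : dualWedge p V f (wedge p V v) =
      ExteriorAlgebra.liftAlternating (R := ℝ) (Pi.single p
        (Matrix.detRowAlternating.compLinearMap (LinearMap.pi f)))
        (ExteriorAlgebra.ιMulti ℝ p v) := rfl
  rw [h, ExteriorAlgebra.liftAlternating_apply_ιMulti, Pi.single_eq_same]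
  rfl

lemma dualWedge_eq (f : Fin p → Module.Dual ℝ V) :
    dualWedge p V f = exteriorPower.pairingDual ℝ V p (exteriorPower.ιMulti ℝ p f) := by
  apply exteriorPower.linearMap_ext
  ext v
  have := dualWedge_wedge p V f v
  rw [wedge_eq] at this
  simp [this]

lemma extPowMap_wedge (h : V →ₗ[ℝ] V) (v : Fin p → V) :
    extPowMap p h (wedge p V v) = wedge p V (fun i => h (v i)) := by
  apply Subtype.ext
  exact ExteriorAlgebra.map_apply_ιMulti h v

/-- The square of a linear form, as a bilinear form. -/
noncomputable def sqForm (φ : Module.Dual ℝ ↥(⋀[ℝ]^p V)) :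
    ↥(⋀[ℝ]^p V) →ₗ[ℝ] ↥(⋀[ℝ]^p V) →ₗ[ℝ] ℝ := φ.smulRight φ

lemma sqForm_apply (φ : Module.Dual ℝ ↥(⋀[ℝ]^p V)) (x y) :
    sqForm p V φ x y = φ x * φ y := rfl

/-- The span of squares of decomposable forms. -/
noncomputable def Kp : Submodule ℝ (↥(⋀[ℝ]^p V) →ₗ[ℝ] ↥(⋀[ℝ]^p V) →ₗ[ℝ] ℝ) :=
  Submodule.span ℝ (Set.range fun f : Fin p → Module.Dual ℝ V => sqForm p V (dualWedge p V f))

lemma Kp_le_Ap : Kp p V ≤ Ap p V := by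
  refine Submodule.span_le.mpr ?_
  rintro _ ⟨f, rfl⟩
  refine ⟨fun x y => by simp [sqForm_apply, mul_comm], fun C hC => ?_⟩
  have h : (Module.evalEquiv ℝ ↥(⋀[ℝ]^p V)).symm.toLinearMap ∘ₗ C ∘ₗ
      sqForm p V (dualWedge p V f) =
      (dualWedge p V f).smulRight ((Module.evalEquiv ℝ ↥(⋀[ℝ]^p V)).symm
        (C (dualWedge p V f))) := by
    ext x
    simp [sqForm]
  show LinearMap.trace ℝ ↥(⋀[ℝ]^p V) _ = 0
  rw [h, LinearMap.trace_smulRight, Module.apply_evalEquiv_symm_apply]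
  exact hC.2 f

section basis

variable {n : ℕ} (e : Basis (Fin n) ℝ V)

lemma toDual_wedge (v : Fin p → V) :
    (e.exteriorPower p).toDual (wedge p V v) = dualWedge p V (fun i => e.toDual (v i)) := by
  refine (e.exteriorPower p).ext fun s => ?_
  rw [Basis.toDual_apply_left, wedge_eq, exteriorPower.basis_repr_apply,
    exteriorPower.ιMultiDual_apply_ιMulti, exteriorPower.basis_apply,
    exteriorPower.ιMulti_family, ← wedge_eq, dualWedge_wedge, ← Matrix.det_transpose]
  congr 1
  ext i j
  simp [Basis.toDual_apply_left]

/-- The Euclidean inner product on bilinear forms. -/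
noncomputable def ipForm :
    LinearMap.BilinForm ℝ (↥(⋀[ℝ]^p V) →ₗ[ℝ] ↥(⋀[ℝ]^p V) →ₗ[ℝ] ℝ) :=
  LinearMap.mk₂ ℝ (fun B D => ∑ i, ∑ j,
      B (e.exteriorPower p i) (e.exteriorPower p j) * D (e.exteriorPower p i) (e.exteriorPower p j))
    (by intros; simp [add_mul, Finset.sum_add_distrib])
    (by intros; simp [mul_assoc, Finset.mul_sum])
    (by intros; simp [mul_add, Finset.sum_add_distrib])
    (by intros; simp [mul_left_comm, Finset.mul_sum])

lemma ipForm_apply (B D) : ipForm p V e B D = ∑ i, ∑ j,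
      B (e.exteriorPower p i) (e.exteriorPower p j) *
        D (e.exteriorPower p i) (e.exteriorPower p j) := rfl

lemma ipForm_definite (B) (h : ipForm p V e B B = 0) : B = 0 := by
  rw [ipForm_apply] at h
  refine (e.exteriorPower p).ext fun i => (e.exteriorPower p).ext fun j => ?_
  rw [Finset.sum_eq_zero_iff_of_nonneg
    (fun i _ => Finset.sum_nonneg fun j _ => mul_self_nonneg _)] at h
  have h1 := h i (Finset.mem_univ _)
  rw [Finset.sum_eq_zero_iff_of_nonneg (fun j _ => mul_self_nonneg _)] at h1
  simpa using h1 j (Finset.mem_univ _)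

lemma ipForm_sq (B) (x : ↥(⋀[ℝ]^p V)) :
    ipForm p V e (sqForm p V ((e.exteriorPower p).toDual x)) B = B x x := by
  rw [ipForm_apply]
  conv_rhs => rw [← (e.exteriorPower p).sum_repr x]
  simp only [map_sum, LinearMap.sum_apply, map_smul, LinearMap.smul_apply, smul_eq_mul,
    sqForm_apply, Basis.toDual_apply_left, Finset.mul_sum]
  rw [Finset.sum_comm]
  refine Finset.sum_congr rfl fun i _ => Finset.sum_congr rfl fun j _ => ?_
  ring

lemma Kp_le_Yp : Kp p V ≤ Yp p V := fun _ h => (Kp_le_Ap p V h).1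

include e in
lemma Yp_le : Yp p V ≤ Kp p V ⊔ Zp p V := by
  intro B hB
  have hrefl : (ipForm p V e).IsRefl := by
    intro B D h
    rw [← h, ipForm_apply, ipForm_apply]
    exact Finset.sum_congr rfl fun i _ => Finset.sum_congr rfl fun j _ => mul_comm _ _
  have hc : IsCompl (Kp p V) ((ipForm p V e).orthogonal (Kp p V)) := by
    refine (LinearMap.BilinForm.isCompl_orthogonal_iff_disjoint (K := ℝ)
      (V := ↥(⋀[ℝ]^p V) →ₗ[ℝ] ↥(⋀[ℝ]^p V) →ₗ[ℝ] ℝ) (B := ipForm p V e) hrefl).mpr ?_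
    rw [Submodule.disjoint_def]
    intro D h1 h2
    exact ipForm_definite p V e D (h2 D h1)
  have : B ∈ Kp p V ⊔ (ipForm p V e).orthogonal (Kp p V) := by
    rw [hc.sup_eq_top]; trivial
  obtain ⟨k, hk, z, hz, rfl⟩ := Submodule.mem_sup.mp this
  refine Submodule.add_mem_sup hk ⟨?_, fun v => ?_⟩
  · exact mem_right hB (Kp_le_Yp p V hk)
  · have := hz (sqForm p V (dualWedge p V fun i => e.toDual (v i)))
      (Submodule.subset_span ⟨_, rfl⟩)
    rw [← toDual_wedge] at this
    rw [← ipForm_sq p V e]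
    exact this

include e in
lemma Ap_inf_Zp (z) (hA : z ∈ Ap p V) (hZ : z ∈ Zp p V) : z = 0 := by
  set b := e.exteriorPower p with hb
  let θ := b.toDualEquiv
  let C : Module.Dual ℝ ↥(⋀[ℝ]^p V) →ₗ[ℝ] Module.Dual ℝ ↥(⋀[ℝ]^p V) →ₗ[ℝ] ℝ :=
    z.compl₁₂ θ.symm.toLinearMap θ.symm.toLinearMap
  have hC : C ∈ ZpDual p V := by
    refine ⟨fun x y => hZ.1 _ _, fun f => ?_⟩
    have h : θ.symm (dualWedge p V f) = wedge p V (fun i => e.toDualEquiv.symm (f i)) := by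
      rw [LinearEquiv.symm_apply_eq]
      show _ = b.toDual _
      rw [hb, toDual_wedge]
      congr 1
      ext1 i
      exact (e.toDualEquiv.apply_symm_apply (f i)).symm
    show z (θ.symm _) (θ.symm _) = 0
    rw [h]
    exact hZ.2 _
  have h0 := hA.2 C hC
  apply ipForm_definite p V e
  rw [← h0, pairingY, LinearMap.trace_eq_matrix_trace ℝ b, Matrix.trace, ipForm_apply]
  refine Finset.sum_congr rfl fun i _ => ?_
  rw [Matrix.diag_apply, LinearMap.toMatrix_apply, ← Basis.coord_apply]
  simp only [LinearMap.comp_apply, LinearEquiv.coe_coe]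
  rw [Module.apply_evalEquiv_symm_apply]
  have h1 : θ.symm (b.coord i) = b i := by
    rw [LinearEquiv.symm_apply_eq]
    exact (b.coe_toDual_self i).symm
  have h2 : θ.symm (z (b i)) = ∑ j, z (b i) (b j) • b j := by
    rw [LinearEquiv.symm_apply_eq]
    refine b.ext fun k => ?_
    show _ = b.toDual _ _
    simp [Basis.toDual_apply]
  show _ = z (θ.symm (z (b i))) (θ.symm (b.coord i))
  rw [h1, h2]
  simp only [map_sum, LinearMap.sum_apply, map_smul, LinearMap.smul_apply, smul_eq_mul]
  refine Finset.sum_congr rfl fun j _ => ?_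
  rw [hZ.1 (b j) (b i)]

end basis

lemma Zp_inv (h : V →ₗ[ℝ] V) (B) (hB : B ∈ Zp p V) :
    B.compl₁₂ (extPowMap p h) (extPowMap p h) ∈ Zp p V := by
  refine ⟨fun x y => hB.1 _ _, fun v => ?_⟩
  rw [LinearMap.compl₁₂_apply, extPowMap_wedge]
  exact hB.2 _

lemma ext_wedge {ι : Type*} (e : Basis ι ℝ V) {N : Type*} [AddCommGroup N] [Module ℝ N]
    (F G : ↥(⋀[ℝ]^p V) →ₗ[ℝ] N)
    (h : ∀ a : Fin p → ι, F (wedge p V (fun i => e (a i))) = G (wedge p V (fun i => e (a i)))) :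
    F = G := by
  apply exteriorPower.linearMap_ext
  exact Basis.ext_alternating e fun a _ => h a

lemma exists_basis (f : Fin p → Module.Dual ℝ V) (hf : LinearIndependent ℝ f) :
    ∃ (κ : Set (Module.Dual ℝ V)) (e : Basis (Fin p ⊕ κ) ℝ V), 
      (∀ i j, f i (e (Sum.inl j)) = if i = j then 1 else 0) ∧ ∀ i j, f i (e (Sum.inr j)) = 0 := by
  classical
  let b := Basis.sumExtend hf
  have hb : ∀ i, b (Sum.inl i) = f i := fun i => by
    simp only [b, Basis.sumExtend, Basis.reindex_apply, Equiv.symm_symm, Basis.extend_apply_self]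
    rfl
  haveI : Finite (Fin p ⊕ Basis.sumExtendIndex hf) := Module.Finite.finite_basis b
  let e := b.dualBasis.map (Module.evalEquiv ℝ V).symm
  have he : ∀ i k, f i (e k) = b.coord k (b (Sum.inl i)) := by
    intro i k
    rw [hb]
    simp [e]
  refine ⟨_, e, ?_, ?_⟩
  · intro i j
    simp [he, Finsupp.single_apply]
  · intro i j
    simp [he, Finsupp.single_apply]

lemma sq_mem 
    (U : Submodule ℝ (↥(⋀[ℝ]^p V) →ₗ[ℝ] ↥(⋀[ℝ]^p V) →ₗ[ℝ] ℝ))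
    (hUinv : ∀ g : V ≃ₗ[ℝ] V, ∀ B ∈ U,
      B.compl₁₂ (extPowMap p g.symm.toLinearMap) (extPowMap p g.symm.toLinearMap) ∈ U)
    (hdisj : Zp p V ⊓ U = ⊥) (hsup : Zp p V ⊔ U = Yp p V)
    (f : Fin p → Module.Dual ℝ V) : sqForm p V (dualWedge p V f) ∈ U := by
  by_cases hf : LinearIndependent ℝ f
  swap
  · have : dualWedge p V f = 0 := by
      rw [dualWedge_eq, AlternatingMap.map_linearDependent _ _ hf, map_zero]
    rw [this]
    have : sqForm p V 0 = 0 := by ext; simp [sqForm]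
    rw [this]; exact U.zero_mem
  obtain ⟨κ, e, he1, he2⟩ := exists_basis p V f hf
  have hY : sqForm p V (dualWedge p V f) ∈ Zp p V ⊔ U := by
    rw [hsup]
    exact Kp_le_Yp p V (Submodule.subset_span ⟨f, rfl⟩)
  obtain ⟨z, hz, u, hu, hzu⟩ := Submodule.mem_sup.mp hY
  let w : Fin p ⊕ κ → ℝˣ := Sum.elim (fun _ => 1) (fun _ => Units.mk0 2 two_ne_zero)
  let h : V ≃ₗ[ℝ] V := e.equiv (e.unitsSMul w) (Equiv.refl _)
  have hh : ∀ i, h (e i) = (w i : ℝ) • e i := by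
    intro i
    simp [h, Basis.unitsSMul_apply, Units.smul_def]
  have hfh : ∀ i x, f i (h x) = f i x := by
    intro i x
    have : f i ∘ₗ h.toLinearMap = f i := by
      refine e.ext fun k => ?_
      rw [LinearMap.comp_apply, LinearEquiv.coe_coe, hh]
      rcases k with k | k
      · simp [w]
      · simp [he2]
    exact LinearMap.congr_fun this x
  have hφ : dualWedge p V f ∘ₗ extPowMap p h.toLinearMap = dualWedge p V f := by
    refine ext_wedge p V e _ _ fun a => ?_
    rw [LinearMap.comp_apply, extPowMap_wedge, dualWedge_wedge, dualWedge_wedge]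
    simp [hfh]
  have hu' := hUinv h.symm u hu
  rw [LinearEquiv.symm_symm] at hu'
  have hz' := Zp_inv p V h.toLinearMap z hz
  have hsq : (sqForm p V (dualWedge p V f)).compl₁₂ (extPowMap p h.toLinearMap)
      (extPowMap p h.toLinearMap) = sqForm p V (dualWedge p V f) := by
    refine LinearMap.ext fun x => LinearMap.ext fun y => ?_
    rw [LinearMap.compl₁₂_apply, sqForm_apply, sqForm_apply]
    exact congrArg₂ (· * ·) (LinearMap.congr_fun hφ x) (LinearMap.congr_fun hφ y)
  have hzz : z.compl₁₂ (extPowMap p h.toLinearMap) (extPowMap p h.toLinearMap) = z := by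
    have hd : z.compl₁₂ (extPowMap p h.toLinearMap) (extPowMap p h.toLinearMap) - z
        ∈ Zp p V ⊓ U := by
      refine ⟨sub_mem' hz' hz, ?_⟩
      have : z.compl₁₂ (extPowMap p h.toLinearMap) (extPowMap p h.toLinearMap) - z =
          u - u.compl₁₂ (extPowMap p h.toLinearMap) (extPowMap p h.toLinearMap) := by
        refine LinearMap.ext fun x => LinearMap.ext fun y => ?_
        have h1 := LinearMap.congr_fun (LinearMap.congr_fun hsq x) y
        rw [← hzu] at h1
        simp only [LinearMap.compl₁₂_apply, LinearMap.add_apply, LinearMap.sub_apply] at h1 ⊢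
        linarith
      rw [this]
      exact sub_mem' hu hu'
    rw [hdisj, Submodule.mem_bot] at hd
    exact sub_eq_zero.mp hd
  have key : ∀ a : Fin p → Fin p ⊕ κ, ∃ c : ℝ, 1 ≤ c ∧
      extPowMap p h.toLinearMap (wedge p V fun i => e (a i)) = c • wedge p V (fun i => e (a i)) ∧
      (2 ≤ c ∨ ∃ r : ℝ, wedge p V (fun i => e (a i)) =
        r • wedge p V (fun i => e (Sum.inl i))) := by
    intro a
    have hw : ∀ k, (1 : ℝ) ≤ w k := by
      rintro (k | k)
      · simp [w]
      · simp [w]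
    refine ⟨∏ i, (w (a i) : ℝ), ?_, ?_, ?_⟩
    · exact Finset.one_le_prod fun i _ => hw _
    · rw [extPowMap_wedge]
      simp only [LinearEquiv.coe_coe, hh]
      exact (exteriorPower.ιMulti ℝ p).map_smul_univ _ _
    · by_cases ha : ∃ i k, a i = Sum.inr k
      · left
        obtain ⟨i, k, hik⟩ := ha
        rw [← Finset.mul_prod_erase _ _ (Finset.mem_univ i)]
        have h1 : (w (a i) : ℝ) = 2 := by simp [hik, w]
        have h2 : (1 : ℝ) ≤ ∏ x ∈ Finset.univ.erase i, (w (a x) : ℝ) :=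
          Finset.one_le_prod fun i _ => hw _
        rw [h1]; linarith
      · right
        have : ∀ i, ∃ k, a i = Sum.inl k := by
          intro i
          rcases hai : a i with k | k
          · exact ⟨k, rfl⟩
          · exact absurd ⟨i, k, hai⟩ ha
        choose σ hσ using this
        simp only [hσ]
        by_cases hinj : Function.Injective σ
        · let τ : Equiv.Perm (Fin p) :=
            Equiv.ofBijective σ (Finite.injective_iff_bijective.mp hinj)
          have := (exteriorPower.ιMulti ℝ p).map_perm (fun i => e (Sum.inl i)) τ
          rcases Int.units_eq_one_or (Equiv.Perm.sign τ) with h1 | h1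
          · rw [h1, one_smul] at this
            exact ⟨1, by rw [one_smul]; exact this⟩
          · rw [h1, Units.neg_smul, one_smul] at this
            exact ⟨-1, this.trans (neg_one_smul ℝ _).symm⟩
        · refine ⟨0, ?_⟩
          rw [zero_smul]
          simp only [Function.Injective, not_forall] at hinj
          obtain ⟨i, j, hij, hne⟩ := hinj
          exact (exteriorPower.ιMulti ℝ p).map_eq_zero_of_eq _ (by simp [hij]) hne
  have hz0 : z = 0 := by
    refine ext_wedge p V e _ _ fun a => ext_wedge p V e _ _ fun b => ?_
    obtain ⟨c, hc1, hc, hca⟩ := key a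
    obtain ⟨d, hd1, hd, hdb⟩ := key b
    have h1 := LinearMap.congr_fun (LinearMap.congr_fun hzz (wedge p V fun i => e (a i)))
      (wedge p V fun i => e (b i))
    rw [LinearMap.compl₁₂_apply, hc, hd, LinearMap.map_smul, LinearMap.map_smul₂,
      smul_eq_mul, smul_eq_mul, mul_left_comm] at h1
    rw [LinearMap.zero_apply, LinearMap.zero_apply]
    rcases hca with hca | ⟨r, hr⟩
    · exact scal h1 (by clear * - hca hd1; nlinarith)
    rcases hdb with hdb | ⟨s, hs⟩
    · exact scal h1 (by clear * - hc1 hdb; nlinarith)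
    rw [hr, hs, LinearMap.map_smul, LinearMap.map_smul₂, hz.2, smul_zero,
      smul_zero]
  rw [← hzu, hz0, zero_add]
  exact hu

end InvCompl

/-- `GL(V)` acts on `Y_p(V)` by `(g · Q)(x, y) = Q((⋀^p g)⁻¹ x, (⋀^p g)⁻¹ y)`.
If `U ⊆ Y_p(V)` is a `GL(V)`-invariant linear subspace with `Y_p(V) = Z_p(V) ⊕ U`, then
`U = A_p(V)`; that is, `A_p(V)` is the unique `GL(V)`-invariant complement of `Z_p(V)`
in `Y_p(V)`. -/
theorem invariant_complement_unique (hp : 1 ≤ p)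
    (U : Submodule ℝ (↥(⋀[ℝ]^p V) →ₗ[ℝ] ↥(⋀[ℝ]^p V) →ₗ[ℝ] ℝ))
    (hUY : U ≤ Yp p V)
    (hUinv : ∀ g : V ≃ₗ[ℝ] V, ∀ B ∈ U,
      B.compl₁₂ (extPowMap p g.symm.toLinearMap) (extPowMap p g.symm.toLinearMap) ∈ U)
    (hdisj : Zp p V ⊓ U = ⊥) (hsup : Zp p V ⊔ U = Yp p V) :
    U = Ap p V := by
  have e := Module.finBasis ℝ V
  have hKU : InvCompl.Kp p V ≤ U := by
    refine Submodule.span_le.mpr ?_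
    rintro _ ⟨f, rfl⟩
    exact InvCompl.sq_mem p V U hUinv hdisj hsup f
  apply le_antisymm
  · intro B hB
    obtain ⟨k, hk, z, hz, rfl⟩ := Submodule.mem_sup.mp (InvCompl.Yp_le p V e (hUY hB))
    have hzU : z ∈ U :=
      InvCompl.mem_right hB (hKU hk)
    have h0 : z ∈ Zp p V ⊓ U := ⟨hz, hzU⟩
    rw [hdisj, Submodule.mem_bot] at h0
    rw [h0, add_zero]
    exact InvCompl.Kp_le_Ap p V hk
  · intro B hB
    obtain ⟨k, hk, z, hz, rfl⟩ := Submodule.mem_sup.mp (InvCompl.Yp_le p V e hB.1)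
    have hzA : z ∈ Ap p V :=
      InvCompl.mem_right hB (InvCompl.Kp_le_Ap p V hk)
    rw [InvCompl.Ap_inf_Zp p V e z hzA hz, add_zero]
    exact hKU hk
end
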